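/- Define ξ(z) := (H_g(z), H_{[f,g]}(z)) so that the singular locus in the cotangent bundle is Σ_SA = ξ⁻¹({0}). Suppose Assumptions A2 and A3 hold at a solution (t_b*, z_b*, λ*) of F = 0, that ξ is a submersion at z_e := exp(−t_b* H⃗₊)(z_b*), and let φ(t_b) := exp(−t_b H⃗₊)(z_b(t_b)) be the switching-curve parametrization from the implicit solution of G = 0. Then ξ'(z_e)·φ'(t_b*) = −(H_{[f,g]}(z_e), H_{[f,[f,g]]}(z_e) + H_{[g,[f,g]]}(z_e)) ≠ 0; in particular the switching curve Σ is transverse to the singular locus Σ_SA at z_e. -/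

import Mathlib

open Set
open scoped RealInnerProductSpace

noncomputable section

/-- The plane, with its Euclidean (inner product) structure. -/
abbrev E2 : Type := EuclideanSpace ℝ (Fin 2)

/-- The cotangent bundle `ℝ² × ℝ² ≅ ℝ⁴`; `z = (x,p)`. -/
abbrev Z4 : Type := E2 × E2

/-- Lie bracket `[f,g](x) = Dg(x)f(x) − Df(x)g(x)`. -/
def lieB (f g : E2 → E2) (x : E2) : E2 :=
  fderiv ℝ g x (f x) - fderiv ℝ f x (g x)

/-- Hamiltonian lift `H_h(z) = p·h(x)`. -/
def Hlift (h : E2 → E2) (z : Z4) : ℝ := ⟪z.2, h z.1⟫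

/-- The Hamiltonian vector field of `H₊ = H_f + H_g`:
`H⃗₊(x,p) = ((f+g)(x), −(Df(x)+Dg(x))ᵀ p)`. -/
def HvecPlus (f g : E2 → E2) (z : Z4) : Z4 :=
  (f z.1 + g z.1,
   -(ContinuousLinearMap.adjoint (fderiv ℝ f z.1 + fderiv ℝ g z.1)) z.2)

/-- The map `G(t_b,z_b,λ) = (H_g(exp(−t_b H⃗₊)(z_b)), H₊(z_b) − 1, Ψ(z_b,λ))`,
with the normal multiplier `p⁰ = −1`. -/
def Gmap (f g : E2 → E2) (Φ : ℝ → Z4 → Z4) (k : ℕ)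
    (Ψ : Z4 → EuclideanSpace ℝ (Fin k) → EuclideanSpace ℝ (Fin (2+k)))
    (tb : ℝ) (zb : Z4) (lam : EuclideanSpace ℝ (Fin k)) :
    ℝ × ℝ × EuclideanSpace ℝ (Fin (2+k)) :=
  (Hlift g (Φ (-tb) zb), Hlift (fun x => f x + g x) zb - 1, Ψ zb lam)

/-- The map `F(t_b,z_b,λ) = (H_{[f,g]}(exp(−t_b H⃗₊)(z_b)), G(t_b,z_b,λ))`. -/
def Fmap (f g : E2 → E2) (Φ : ℝ → Z4 → Z4) (k : ℕ)
    (Ψ : Z4 → EuclideanSpace ℝ (Fin k) → EuclideanSpace ℝ (Fin (2+k)))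
    (tb : ℝ) (zb : Z4) (lam : EuclideanSpace ℝ (Fin k)) :
    ℝ × ℝ × ℝ × EuclideanSpace ℝ (Fin (2+k)) :=
  (Hlift (lieB f g) (Φ (-tb) zb), Gmap f g Φ k Ψ tb zb lam)

/-- `ξ(z) = (H_g(z), H_{[f,g]}(z))`, whose zero set is the singular locus
`Σ_SA` in the cotangent bundle. -/
def ξmap (f g : E2 → E2) (z : Z4) : ℝ × ℝ := (Hlift g z, Hlift (lieB f g) z)

/-- If `t ↦ u (t, c t)` vanishes near `t₀`, the partial derivative of `u` in `t` vanishes and its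
partial derivative in the second variable is injective, then `c` has zero derivative at `t₀`. -/
theorem hasDerivAt_zero_of_implicit {E F : Type*} [NormedAddCommGroup E] [NormedSpace ℝ E]
    [NormedAddCommGroup F] [NormedSpace ℝ F] {u : ℝ × E → F} {c : ℝ → E} {t₀ : ℝ}
    (hu : DifferentiableAt ℝ u (t₀, c t₀)) (hc : DifferentiableAt ℝ c t₀)
    (hzero : (fun t => u (t, c t)) =ᶠ[nhds t₀] fun _ => 0)
    (ht : HasDerivAt (fun t => u (t, c t₀)) 0 t₀)
    (hinj : Function.Injective (fderiv ℝ (fun q => u (t₀, q)) (c t₀))) :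
    HasDerivAt c 0 t₀ := by
  have hD := hu.hasFDerivAt
  have hcurve : HasDerivAt (fun t => u (t, c t)) (fderiv ℝ u (t₀, c t₀) (1, deriv c t₀)) t₀ :=
    hD.comp_hasDerivAt t₀ ((hasDerivAt_id t₀).prodMk hc.hasDerivAt)
  have hfst : HasDerivAt (fun t => u (t, c t₀)) (fderiv ℝ u (t₀, c t₀) (1, 0)) t₀ :=
    hD.comp_hasDerivAt t₀ ((hasDerivAt_id t₀).prodMk (hasDerivAt_const t₀ (c t₀)))
  have hsnd : HasFDerivAt (fun q => u (t₀, q))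
      ((fderiv ℝ u (t₀, c t₀)).comp (ContinuousLinearMap.inr ℝ ℝ E)) (c t₀) :=
    hD.comp (c t₀) (hasFDerivAt_prodMk_right t₀ (c t₀))
  have h1 : fderiv ℝ u (t₀, c t₀) (1, deriv c t₀) = 0 :=
    hcurve.unique ((hasDerivAt_const t₀ (0 : F)).congr_of_eventuallyEq hzero)
  have h2 : fderiv ℝ u (t₀, c t₀) (1, 0) = 0 := hfst.unique ht
  have h3 : fderiv ℝ u (t₀, c t₀) (0, deriv c t₀) = 0 := by
    have hsplit : ((0 : ℝ), deriv c t₀) = (1, deriv c t₀) - (1, 0) := by simp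
    rw [hsplit, map_sub, h1, h2, sub_zero]
  have h4 : deriv c t₀ = 0 := by
    apply hinj
    rw [hsnd.fderiv, map_zero]
    simpa using h3
  exact h4 ▸ hc.hasDerivAt

theorem hasFDerivAt_Hlift {h : E2 → E2} {z : Z4} (hh : DifferentiableAt ℝ h z.1) :
    HasFDerivAt (Hlift h)
      ((fderivInnerCLM ℝ (z.2, h z.1)).comp ((ContinuousLinearMap.snd ℝ E2 E2).prod
        ((fderiv ℝ h z.1).comp (ContinuousLinearMap.fst ℝ E2 E2)))) z :=
  hasFDerivAt_snd.inner ℝ (hh.hasFDerivAt.comp z hasFDerivAt_fst)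

theorem differentiableAt_Hlift {h : E2 → E2} {z : Z4} (hh : DifferentiableAt ℝ h z.1) :
    DifferentiableAt ℝ (Hlift h) z :=
  (hasFDerivAt_Hlift hh).differentiableAt

/-- The derivative of a Hamiltonian lift along `H⃗₊` is the lift of the Lie bracket. -/
theorem fderiv_Hlift_HvecPlus (f g : E2 → E2) {h : E2 → E2} {z : Z4}
    (hh : DifferentiableAt ℝ h z.1) :
    fderiv ℝ (Hlift h) z (HvecPlus f g z) = Hlift (lieB f h) z + Hlift (lieB g h) z := by
  rw [(hasFDerivAt_Hlift hh).fderiv]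
  simp only [HvecPlus, Hlift, lieB, ContinuousLinearMap.comp_apply, ContinuousLinearMap.prod_apply,
    ContinuousLinearMap.coe_fst', ContinuousLinearMap.coe_snd', fderivInnerCLM_apply,
    inner_neg_left, ContinuousLinearMap.adjoint_inner_left, map_add, inner_add_left,
    inner_add_right, inner_sub_right, add_apply]
  ring

theorem lieB_self (g : E2 → E2) (x : E2) : lieB g g x = 0 := sub_self _

theorem contDiff_lieB {f g : E2 → E2} (hf : ContDiff ℝ (⊤ : ℕ∞) f) (hg : ContDiff ℝ (⊤ : ℕ∞) g) :
    ContDiff ℝ (⊤ : ℕ∞) (lieB f g) :=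
  ((hg.fderiv_right le_rfl).clm_apply hf).sub ((hf.fderiv_right le_rfl).clm_apply hg)

/-- Corollary `cor:tansversality_property`: under Assumptions
A2 and A3, if `ξ` is a submersion at `z_e`, then for the switching-curve
parametrization `φ(t_b) = exp(−t_b H⃗₊)(z_b(t_b))` one has
`ξ'(z_e)·φ'(t_b*) = −(H_{[f,g]}(z_e), H_{[f,[f,g]]}(z_e)+H_{[g,[f,g]]}(z_e)) ≠ 0`;
in particular the switching curve `Σ` is transverse to the singular locus
`Σ_SA` at `z_e`. -/
theorem stmt17 (f g : E2 → E2)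
    (hf : ContDiff ℝ (⊤ : ℕ∞) f) (hg : ContDiff ℝ (⊤ : ℕ∞) g)
    (k : ℕ) (Ψ : Z4 → EuclideanSpace ℝ (Fin k) → EuclideanSpace ℝ (Fin (2+k)))
    (hΨ : ContDiff ℝ (⊤ : ℕ∞) (fun q : Z4 × EuclideanSpace ℝ (Fin k) => Ψ q.1 q.2))
    -- the complete flow Φ of H⃗₊
    (Φ : ℝ → Z4 → Z4)
    (hΦsmooth : ContDiff ℝ (⊤ : ℕ∞) (fun q : ℝ × Z4 => Φ q.1 q.2))
    (hΦ0 : ∀ z : Z4, Φ 0 z = z)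
    (hΦd : ∀ (t : ℝ) (z : Z4), HasDerivAt (fun s => Φ s z) (HvecPlus f g (Φ t z)) t)
    -- the solution of F = 0 and the prior-saturation lift z_e
    (tbs : ℝ) (zbs : Z4) (lams : EuclideanSpace ℝ (Fin k))
    (hsol : Fmap f g Φ k Ψ tbs zbs lams = 0)
    (ze : Z4) (hze : ze = Φ (-tbs) zbs)
    -- Assumption A2
    (hA2 : Hlift (lieB g (lieB f g)) ze ≠ 0 ∧
      -Hlift (lieB f (lieB f g)) ze / Hlift (lieB g (lieB f g)) ze < 1)
    -- Assumption A3
    (hA3 : Function.Bijective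
      (fderiv ℝ (fun q : Z4 × EuclideanSpace ℝ (Fin k) =>
        Gmap f g Φ k Ψ tbs q.1 q.2) (zbs, lams)))
    -- ξ is a submersion at z_e
    (hsub : Function.Surjective (fderiv ℝ (ξmap f g) ze))
    -- the C¹ implicit solution σ of G = 0 near t_b*
    (ε : ℝ) (hε : 0 < ε) (σ : ℝ → Z4 × EuclideanSpace ℝ (Fin k))
    (hσC1 : ContDiffOn ℝ 1 σ (Ioo (tbs - ε) (tbs + ε)))
    (hσG : ∀ tb ∈ Ioo (tbs - ε) (tbs + ε),
      Gmap f g Φ k Ψ tb (σ tb).1 (σ tb).2 = 0)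
    (hσs : σ tbs = (zbs, lams)) :
    ∀ v : Z4, HasDerivAt (fun tb : ℝ => Φ (-tb) (σ tb).1) v tbs →
      fderiv ℝ (ξmap f g) ze v
        = -(Hlift (lieB f g) ze,
            Hlift (lieB f (lieB f g)) ze + Hlift (lieB g (lieB f g)) ze) ∧
      fderiv ℝ (ξmap f g) ze v ≠ 0 := by
  intro v hv
  have hg' : Differentiable ℝ g := hg.differentiable (by simp)
  have hl' : Differentiable ℝ (lieB f g) := (contDiff_lieB hf hg).differentiable (by simp)
  have hΦ' : Differentiable ℝ (fun q : ℝ × Z4 => Φ q.1 q.2) := hΦsmooth.differentiable (by simp)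
  have hHg : Differentiable ℝ (Hlift g) := fun z => differentiableAt_Hlift (hg' z.1)
  have hHl : Differentiable ℝ (Hlift (lieB f g)) := fun z => differentiableAt_Hlift (hl' z.1)
  have hHs : Differentiable ℝ (Hlift fun x => f x + g x) := fun z =>
    differentiableAt_Hlift ((hf.add hg).differentiable (by simp) z.1)
  have hlie : Hlift (lieB f g) ze = 0 := hze ▸ congrArg Prod.fst hsol
  have hself : Hlift (lieB g g) ze = 0 := by simp [Hlift, lieB_self]
  have hback : Differentiable ℝ (fun q : ℝ × Z4 => Φ (-q.1) q.2) :=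
    hΦ'.comp (differentiable_fst.neg.prodMk differentiable_snd)
  have hσd : DifferentiableAt ℝ σ tbs :=
    (hσC1.differentiableOn one_ne_zero).differentiableAt
      (Ioo_mem_nhds (by linarith) (by linarith))
  have hflow : HasDerivAt (fun t => Φ (-t) zbs) (-HvecPlus f g ze) tbs := by
    have := (hΦd (-tbs) zbs).scomp tbs (hasDerivAt_neg tbs)
    rw [← hze] at this
    simpa [Function.comp_def] using this
  have hσ0 : HasDerivAt σ 0 tbs := by
    refine hasDerivAt_zero_of_implicit
      (u := fun q : ℝ × Z4 × EuclideanSpace ℝ (Fin k) => Gmap f g Φ k Ψ q.1 q.2.1 q.2.2)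
      ?_ hσd ?_ ?_ ?_
    · have h1 : Differentiable ℝ fun q : ℝ × Z4 × EuclideanSpace ℝ (Fin k) =>
          Hlift g (Φ (-q.1) q.2.1) :=
        hHg.comp (hback.comp (differentiable_fst.prodMk differentiable_snd.fst))
      have h2 : Differentiable ℝ fun q : ℝ × Z4 × EuclideanSpace ℝ (Fin k) =>
          Hlift (fun x => f x + g x) q.2.1 - 1 :=
        (hHs.comp differentiable_snd.fst).sub_const 1
      have h3 : Differentiable ℝ fun q : ℝ × Z4 × EuclideanSpace ℝ (Fin k) => Ψ q.2.1 q.2.2 :=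
        (hΨ.differentiable (by simp)).comp differentiable_snd
      exact (h1.prodMk (h2.prodMk h3)) _
    · filter_upwards [Ioo_mem_nhds (by linarith : tbs - ε < tbs) (by linarith : tbs < tbs + ε)]
        with t ht using hσG t ht
    · simp only [hσs, Gmap]
      have h1 : HasDerivAt (fun t => Hlift g (Φ (-t) zbs)) 0 tbs := by
        have := (hHg (Φ (-tbs) zbs)).hasFDerivAt.comp_hasDerivAt tbs hflow
        rwa [← hze, map_neg, fderiv_Hlift_HvecPlus f g (hg' _), hlie, hself, add_zero,
          neg_zero] at this
      exact h1.prodMk ((hasDerivAt_const _ _).prodMk (hasDerivAt_const _ _))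
    · rw [hσs]
      exact hA3.injective
  have hvflow : v = -HvecPlus f g ze := by
    have hD := (hback (tbs, zbs)).hasFDerivAt
    have hz : HasDerivAt (fun t => (σ t).1) 0 tbs := hσ0.fst
    have hcurve : HasDerivAt (fun t => Φ (-t) (σ t).1)
        (fderiv ℝ (fun q : ℝ × Z4 => Φ (-q.1) q.2) (tbs, zbs) (1, 0)) tbs := by
      refine HasFDerivAt.comp_hasDerivAt (l := fun q : ℝ × Z4 => Φ (-q.1) q.2) tbs ?_
        ((hasDerivAt_id tbs).prodMk hz)
      simpa [hσs] using hD
    have hfixed : HasDerivAt (fun t => Φ (-t) zbs)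
        (fderiv ℝ (fun q : ℝ × Z4 => Φ (-q.1) q.2) (tbs, zbs) (1, 0)) tbs :=
      HasFDerivAt.comp_hasDerivAt (l := fun q : ℝ × Z4 => Φ (-q.1) q.2) tbs hD
        ((hasDerivAt_id tbs).prodMk (hasDerivAt_const tbs zbs))
    exact (hv.unique hcurve).trans (hfixed.unique hflow)
  have hξ : fderiv ℝ (ξmap f g) ze v
      = -(Hlift (lieB f g) ze,
          Hlift (lieB f (lieB f g)) ze + Hlift (lieB g (lieB f g)) ze) := by
    have hpair : HasFDerivAt (ξmap f g)
        ((fderiv ℝ (Hlift g) ze).prod (fderiv ℝ (Hlift (lieB f g)) ze)) ze :=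
      (hHg ze).hasFDerivAt.prodMk (hHl ze).hasFDerivAt
    rw [hpair.fderiv, hvflow, map_neg, ContinuousLinearMap.prod_apply,
      fderiv_Hlift_HvecPlus f g (hg' _), fderiv_Hlift_HvecPlus f g (hl' _), hself, add_zero]
  refine ⟨hξ, fun h0 => ?_⟩
  rw [hξ, neg_eq_zero] at h0
  have hsum : Hlift (lieB f (lieB f g)) ze + Hlift (lieB g (lieB f g)) ze = 0 :=
    congrArg Prod.snd h0
  have hlt := hA2.2
  rw [neg_eq_of_add_eq_zero_right hsum, div_self hA2.1] at hlt
  exact lt_irrefl _ hlt
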